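/- Let ℓ ≥ 1, let F_ℓ = ℓP_3 be the disjoint union of ℓ paths on 3 vertices, and set p = ℓ − 1 ≥ 1. Then there exists N such that for all n ≥ N, every F_ℓ-free simple graph G on n vertices satisfies q(G) ≤ s(n,p), with equality if and only if G is isomorphic to F_{n,p}; here s(n,p) = (n + 2p + √((n + 2p − 4)² − 8p(p − 2)))/2 if n − p is even, and s(n,p) is the largest real root of g(x) − 2p(n − p − 3) = 0 if n − p is odd, where g(x) = x³ − (n + 3p)x² + (4p² + np + 2n − 4)x − 2p²(p+1). -/

import Mathlib

open SimpleGraph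
open scoped Classical

/-- The largest element of the real spectrum of a real matrix (for a real symmetric
matrix this is the largest eigenvalue). -/
noncomputable def specRad {n : ℕ} (M : Matrix (Fin n) (Fin n) ℝ) : ℝ :=
  sSup (spectrum ℝ M)

/-- The diagonal degree matrix of a simple graph on `Fin n`. -/
noncomputable def degMat {n : ℕ} (G : SimpleGraph (Fin n)) : Matrix (Fin n) (Fin n) ℝ :=
  Matrix.diagonal fun i => (Nat.card {j // G.Adj i j} : ℝ)

/-- The adjacency matrix (over `ℝ`) of a simple graph on `Fin n`. -/
noncomputable def adjMat {n : ℕ} (G : SimpleGraph (Fin n)) : Matrix (Fin n) (Fin n) ℝ :=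
  Matrix.of fun i j => if G.Adj i j then (1 : ℝ) else 0

/-- The `A_α`-spectral radius of a graph: largest eigenvalue of `α D + (1-α) A`. -/
noncomputable def rhoAlpha (α : ℝ) {n : ℕ} (G : SimpleGraph (Fin n)) : ℝ :=
  specRad (α • degMat G + (1 - α) • adjMat G)

/-- The signless Laplacian spectral radius of a graph: largest eigenvalue of `D + A`. -/
noncomputable def qRad {n : ℕ} (G : SimpleGraph (Fin n)) : ℝ :=
  specRad (degMat G + adjMat G)

/-- `G` contains a subgraph isomorphic to the linear forest `⋃ i, P_{k i}`:
there are vertex-disjoint copies of the paths `P_{k i}` in `G`. -/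
def ContainsLinearForest {V : Type*} (G : SimpleGraph V) {ℓ : ℕ} (k : Fin ℓ → ℕ) : Prop :=
  ∃ f : (i : Fin ℓ) → Fin (k i) → V,
    (Function.Injective fun q : (i : Fin ℓ) × Fin (k i) => f q.1 q.2) ∧
    ∀ (i : Fin ℓ) (a b : Fin (k i)),
      (SimpleGraph.pathGraph (k i)).Adj a b → G.Adj (f i a) (f i b)

/-- `G` contains a subgraph isomorphic to `H`. -/
def Contains {V W : Type*} (G : SimpleGraph V) (H : SimpleGraph W) : Prop :=
  ∃ f : W ↪ V, ∀ a b, H.Adj a b → G.Adj (f a) (f b)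

/-- `S_{n,p} = K_p ∇ (empty graph on n-p vertices)`, realized on `Fin n` with the
first `p` vertices forming the dominating clique. -/
def Snp (n p : ℕ) : SimpleGraph (Fin n) :=
  SimpleGraph.fromRel fun i j => i.val < p ∨ j.val < p

/-- `S⁺_{n,p} = K_p ∇ (empty graph on n-p-2 vertices ∪ K_2)`, realized on `Fin n` with the
first `p` vertices forming the dominating clique and the last two vertices adjacent. -/
def SnpPlus (n p : ℕ) : SimpleGraph (Fin n) :=
  SimpleGraph.fromRel fun i j =>
    i.val < p ∨ j.val < p ∨ (n - 2 ≤ i.val ∧ n - 2 ≤ j.val)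

/-- `F_{n,p} = K_p ∇ (t K_2 ∪ r K_1)` where `n - p = 2t + r`, `0 ≤ r < 2`, realized on
`Fin n`: the first `p` vertices form the dominating clique and the remaining vertices
are paired into `t` independent edges (plus possibly one isolated vertex). -/
def Fnp (n p : ℕ) : SimpleGraph (Fin n) :=
  SimpleGraph.fromRel fun i j =>
    i.val < p ∨ j.val < p ∨
      (p ≤ i.val ∧ p ≤ j.val ∧ i.val < p + 2 * ((n - p) / 2) ∧
        j.val < p + 2 * ((n - p) / 2) ∧ (i.val - p) / 2 = (j.val - p) / 2)

/-- The disjoint union of cliques of size `c` on `Fin n` (blocks of consecutive vertices). -/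
def unionCliques (n c : ℕ) : SimpleGraph (Fin n) :=
  SimpleGraph.fromRel fun i j => i.val / c = j.val / c

/-- `K_c ∪ M_{n-c}` on `Fin n`: the first `c` vertices form a clique, the remaining
vertices induce a maximal matching `M_{n-c}` (plus possibly one isolated vertex). -/
def KcupM (n c : ℕ) : SimpleGraph (Fin n) :=
  SimpleGraph.fromRel fun i j =>
    (i.val < c ∧ j.val < c) ∨
      (c ≤ i.val ∧ c ≤ j.val ∧ i.val < c + 2 * ((n - c) / 2) ∧
        j.val < c + 2 * ((n - c) / 2) ∧ (i.val - c) / 2 = (j.val - c) / 2)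

/-- The cubic polynomial `f` from the paper. -/
noncomputable def fpoly (α : ℝ) (n p : ℕ) (x : ℝ) : ℝ :=
  x ^ 3 - ((p : ℝ) + (n : ℝ) * α + (p : ℝ) * α) * x ^ 2 +
    ((p : ℝ) - (n : ℝ) * (p : ℝ) + (n : ℝ) * α - 2 * (p : ℝ) * α + (p : ℝ) ^ 2 +
      (n : ℝ) * (p : ℝ) * α ^ 2 + 2 * (n : ℝ) * (p : ℝ) * α - 1) * x +
    (p : ℝ) ^ 2 * α ^ 2 - 2 * (p : ℝ) + (p : ℝ) ^ 3 * α ^ 2 + (n : ℝ) * (p : ℝ) +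
    5 * (p : ℝ) * α - 2 * α ^ 2 + (p : ℝ) ^ 2 * α - (p : ℝ) ^ 3 * α - (p : ℝ) ^ 2 +
    (n : ℝ) * (p : ℝ) ^ 2 * α - 2 * (n : ℝ) * (p : ℝ) ^ 2 * α ^ 2 -
    2 * (n : ℝ) * (p : ℝ) * α

/-- The cubic polynomial `g` from the paper. -/
noncomputable def gpoly (n p : ℕ) (x : ℝ) : ℝ :=
  x ^ 3 - ((n : ℝ) + 3 * (p : ℝ)) * x ^ 2 +
    (4 * (p : ℝ) ^ 2 + (n : ℝ) * (p : ℝ) + 2 * (n : ℝ) - 4) * x -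
    2 * (p : ℝ) ^ 2 * ((p : ℝ) + 1)

/-- The `i`-th coordinate of the signless Laplacian of `G` applied to `v`. -/
noncomputable def qAct {n : ℕ} (G : SimpleGraph (Fin n)) (v : Fin n → ℝ) (i : Fin n) : ℝ :=
  ∑ j, if G.Adj i j then v i + v j else 0

theorem mulVec_eq_qAct {n : ℕ} (G : SimpleGraph (Fin n)) (v : Fin n → ℝ) (i : Fin n) :
    ((degMat G + adjMat G).mulVec v) i = qAct G v i := by
  have hdeg : (Nat.card {j // G.Adj i j} : ℝ) = ∑ j, if G.Adj i j then (1 : ℝ) else 0 := by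
    rw [Nat.card_eq_fintype_card, Fintype.card_subtype]
    simp
  rw [Matrix.add_mulVec, Pi.add_apply, degMat, Matrix.mulVec_diagonal, hdeg, qAct,
    Finset.sum_mul, Matrix.mulVec, dotProduct, ← Finset.sum_add_distrib]
  refine Finset.sum_congr rfl fun j _ => ?_
  by_cases h : G.Adj i j <;> simp [adjMat, h]

theorem mem_spectrum_iff_exists_qAct {n : ℕ} (G : SimpleGraph (Fin n)) (μ : ℝ) :
    μ ∈ spectrum ℝ (degMat G + adjMat G) ↔
      ∃ w : Fin n → ℝ, w ≠ 0 ∧ ∀ i, qAct G w i = μ * w i := by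
  rw [spectrum.mem_iff, Matrix.isUnit_iff_isUnit_det, isUnit_iff_ne_zero, not_not,
    ← Matrix.exists_mulVec_eq_zero_iff]
  refine exists_congr fun w => and_congr_right fun _ => ?_
  rw [funext_iff]
  refine forall_congr' fun i => ?_
  rw [Matrix.sub_mulVec, Pi.sub_apply, mulVec_eq_qAct, Algebra.algebraMap_eq_smul_one,
    Matrix.smul_mulVec, Matrix.one_mulVec]
  simp only [Pi.smul_apply, smul_eq_mul, Pi.zero_apply]
  rw [sub_eq_zero, eq_comm]

/-- A positive vector `v` with `Q v ≤ s v` bounds every eigenvalue by `s`; if `s` is attained,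
the inequality is an equality on a nonempty set of vertices closed under adjacency. -/
theorem eigenvalue_le_of_qAct_le {n : ℕ} (G : SimpleGraph (Fin n)) {v : Fin n → ℝ}
    (hv : ∀ i, 0 < v i) {s : ℝ} (h : ∀ i, qAct G v i ≤ s * v i) {w : Fin n → ℝ} (hw : w ≠ 0)
    {μ : ℝ} (hμ : ∀ i, qAct G w i = μ * w i) :
    μ ≤ s ∧ (μ = s → ∃ S : Set (Fin n), S.Nonempty ∧
      ∀ i ∈ S, qAct G v i = s * v i ∧ ∀ j, G.Adj i j → j ∈ S) := by
  obtain ⟨k, hk⟩ := Function.ne_iff.mp hw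
  have : Nonempty (Fin n) := ⟨k⟩
  obtain ⟨m, hm⟩ := Finite.exists_max fun i => |w i| / v i
  set c := |w m| / v m with hc
  have hle : ∀ j, |w j| ≤ c * v j := fun j => (div_le_iff₀ (hv j)).mp (hm j)
  have hcpos : 0 < c := lt_of_lt_of_le (div_pos (abs_pos.mpr hk) (hv k)) (hm k)
  have hterm : ∀ i j, (if G.Adj i j then |w i| + |w j| else 0) ≤
      c * (if G.Adj i j then v i + v j else 0) := by
    intro i j
    split_ifs
    · linarith [hle i, hle j]
    · simp
  have habs : ∀ i, |qAct G w i| ≤ qAct G (fun j => |w j|) i := by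
    intro i
    refine (Finset.abs_sum_le_sum_abs _ _).trans (Finset.sum_le_sum fun j _ => ?_)
    split_ifs
    · exact abs_add_le _ _
    · simp
  have hmid : ∀ i, qAct G (fun j => |w j|) i ≤ c * qAct G v i := by
    intro i
    rw [qAct, qAct, Finset.mul_sum]
    exact Finset.sum_le_sum fun j _ => hterm i j
  have hlow : ∀ i, |w i| = c * v i → μ * (c * v i) ≤ qAct G (fun j => |w j|) i := by
    intro i hi
    refine le_trans ?_ (habs i)
    rw [hμ i, abs_mul, hi]
    exact mul_le_mul_of_nonneg_right (le_abs_self μ) (mul_pos hcpos (hv i)).le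
  have hmm : |w m| = c * v m := by rw [hc, div_mul_cancel₀ _ (hv m).ne']
  constructor
  · have h1 := hlow m hmm
    have h2 := hmid m
    have h3 := mul_le_mul_of_nonneg_left (h m) hcpos.le
    have h4 : μ * (c * v m) ≤ s * (c * v m) := by linarith
    exact le_of_mul_le_mul_right h4 (mul_pos hcpos (hv m))
  · rintro rfl
    refine ⟨{i | |w i| = c * v i}, ⟨m, hmm⟩, fun i hi => ?_⟩
    have h1 := hlow i hi
    have h2 := hmid i
    have h3 := mul_le_mul_of_nonneg_left (h i) hcpos.le
    refine ⟨le_antisymm (h i) (le_of_mul_le_mul_left (by linarith) hcpos), fun j hj => ?_⟩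
    have heq : qAct G (fun j => |w j|) i = c * qAct G v i := by linarith
    rw [qAct, qAct, Finset.mul_sum] at heq
    have := (Finset.sum_eq_sum_iff_of_le fun j _ => hterm i j).mp heq j (Finset.mem_univ j)
    simp only [hj, if_true] at this
    have hi' : |w i| = c * v i := hi
    change |w j| = c * v j
    linarith

theorem qRad_le_of_qAct_le {n : ℕ} (G : SimpleGraph (Fin n)) {v : Fin n → ℝ}
    (hv : ∀ i, 0 < v i) {s : ℝ} (hs : 0 ≤ s) (h : ∀ i, qAct G v i ≤ s * v i) : qRad G ≤ s := by
  refine Real.sSup_le (fun μ hμ => ?_) hs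
  obtain ⟨w, hw, hμw⟩ := (mem_spectrum_iff_exists_qAct G μ).mp hμ
  exact (eigenvalue_le_of_qAct_le G hv h hw hμw).1

theorem exists_tight_of_qRad_eq {n : ℕ} (G : SimpleGraph (Fin n)) {v : Fin n → ℝ}
    (hv : ∀ i, 0 < v i) {s : ℝ} (hs : 0 < s) (h : ∀ i, qAct G v i ≤ s * v i) (hq : qRad G = s) :
    ∃ S : Set (Fin n), S.Nonempty ∧
      ∀ i ∈ S, qAct G v i = s * v i ∧ ∀ j, G.Adj i j → j ∈ S := by
  have hne : (spectrum ℝ (degMat G + adjMat G)).Nonempty := by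
    by_contra hempty
    rw [Set.not_nonempty_iff_eq_empty] at hempty
    rw [qRad, specRad, hempty, Real.sSup_empty] at hq
    exact hs.ne hq
  have hmem : s ∈ spectrum ℝ (degMat G + adjMat G) :=
    hq ▸ hne.csSup_mem (Matrix.finite_spectrum _)
  obtain ⟨w, hw, hμw⟩ := (mem_spectrum_iff_exists_qAct G s).mp hmem
  exact (eigenvalue_le_of_qAct_le G hv h hw hμw).2 rfl

theorem qRad_eq_of_qAct_eq {n : ℕ} (G : SimpleGraph (Fin n)) {v : Fin n → ℝ} (hn : 0 < n)
    (hv : ∀ i, 0 < v i) {s : ℝ} (hs : 0 ≤ s) (h : ∀ i, qAct G v i = s * v i) : qRad G = s := by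
  refine le_antisymm (qRad_le_of_qAct_le G hv hs fun i => (h i).le) ?_
  refine le_csSup (Matrix.finite_spectrum _).bddAbove ?_
  exact (mem_spectrum_iff_exists_qAct G s).mpr
    ⟨v, fun hv0 => (hv ⟨0, hn⟩).ne' (congrFun hv0 _), h⟩

/-- The vertices outside `L` that have no neighbour outside `L`. -/
noncomputable def outerIsolated {n : ℕ} (G : SimpleGraph (Fin n)) (L : Finset (Fin n)) :
    Finset (Fin n) :=
  Finset.univ.filter fun i => i ∉ L ∧ ∀ j, j ∉ L → ¬ G.Adj i j

/-- Outside `L`, the edges of `G` form a matching. -/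
def OuterMatching {n : ℕ} (G : SimpleGraph (Fin n)) (L : Finset (Fin n)) : Prop :=
  ∀ i j k, i ∉ L → j ∉ L → k ∉ L → G.Adj i j → G.Adj i k → j = k

/-- `G` is the join of the clique on `L` with a matching that misses at most one vertex. -/
structure IsJoinMatching {n : ℕ} (G : SimpleGraph (Fin n)) (L : Finset (Fin n)) : Prop where
  joined : ∀ i ∈ L, ∀ j, j ≠ i → G.Adj i j
  matching : OuterMatching G L
  isolated : (outerIsolated G L).card ≤ 1

/-- The involution of the vertices outside `L` that swaps the ends of every matching edge. -/
noncomputable def partner {n : ℕ} (G : SimpleGraph (Fin n)) (L : Finset (Fin n))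
    (x : {x // ¬ x ∈ L}) : {x // ¬ x ∈ L} :=
  if h : ∃ y : {x // ¬ x ∈ L}, G.Adj x y then h.choose else x

theorem partner_eq {n : ℕ} {G : SimpleGraph (Fin n)} {L : Finset (Fin n)}
    (hM : OuterMatching G L) {x y : {x // ¬ x ∈ L}} (h : G.Adj x y) : partner G L x = y := by
  have hex : ∃ y : {x // ¬ x ∈ L}, G.Adj x y := ⟨y, h⟩
  rw [partner, dif_pos hex]
  exact Subtype.ext (hM x _ _ x.2 hex.choose.2 y.2 hex.choose_spec h)

theorem adj_partner_or_eq {n : ℕ} (G : SimpleGraph (Fin n)) (L : Finset (Fin n))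
    (x : {x // ¬ x ∈ L}) : G.Adj x (partner G L x) ∨
      (partner G L x = x ∧ ∀ y : {x // ¬ x ∈ L}, ¬ G.Adj x y) := by
  by_cases hex : ∃ y : {x // ¬ x ∈ L}, G.Adj x y
  · left
    rw [partner, dif_pos hex]
    exact hex.choose_spec
  · right
    rw [partner, dif_neg hex]
    exact ⟨rfl, not_exists.mp hex⟩

theorem partner_involutive {n : ℕ} {G : SimpleGraph (Fin n)} {L : Finset (Fin n)}
    (hM : OuterMatching G L) : Function.Involutive (partner G L) := by
  intro x
  rcases adj_partner_or_eq G L x with h | h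
  · exact partner_eq hM h.symm
  · rw [h.1, h.1]

theorem adj_iff_partner {n : ℕ} {G : SimpleGraph (Fin n)} {L : Finset (Fin n)}
    (hM : OuterMatching G L) (x y : {x // ¬ x ∈ L}) :
    G.Adj x y ↔ x ≠ y ∧ partner G L x = y := by
  constructor
  · exact fun h => ⟨fun hxy => h.ne (congrArg _ hxy), partner_eq hM h⟩
  · rintro ⟨hne, rfl⟩
    rcases adj_partner_or_eq G L x with h | h
    · exact h
    · exact absurd h.1.symm hne

theorem partner_eq_self_iff {n : ℕ} {G : SimpleGraph (Fin n)} {L : Finset (Fin n)}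
    (hM : OuterMatching G L) (x : {x // ¬ x ∈ L}) :
    partner G L x = x ↔ (x : Fin n) ∈ outerIsolated G L := by
  rw [outerIsolated, Finset.mem_filter]
  constructor
  · intro h
    refine ⟨Finset.mem_univ _, x.2, fun j hj hadj => ?_⟩
    have := partner_eq (y := ⟨j, hj⟩) hM hadj
    rw [h] at this
    exact hadj.ne (congrArg Subtype.val this)
  · rintro ⟨-, -, h⟩
    rcases adj_partner_or_eq G L x with hpar | hpar
    · exact absurd hpar (h _ (partner G L x).2)
    · exact hpar.1

/-- `partner` as a permutation. -/
noncomputable def partnerPerm {n : ℕ} {G : SimpleGraph (Fin n)} {L : Finset (Fin n)}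
    (hM : OuterMatching G L) : Equiv.Perm {x // ¬ x ∈ L} :=
  (partner_involutive hM).toPerm

theorem cycleType_partnerPerm {n : ℕ} {G : SimpleGraph (Fin n)} {L : Finset (Fin n)}
    (hM : OuterMatching G L) : ∃ k, (partnerPerm hM).cycleType = Multiset.replicate k 2 ∧
      2 * k + (outerIsolated G L).card + L.card = n := by
  have hsq : partnerPerm hM ^ 2 = 1 := by
    ext x
    simp [sq, partnerPerm, partner_involutive hM x]
  have hrep := Multiset.eq_replicate_card.mpr (Equiv.Perm.pow_prime_eq_one_iff.mp hsq)
  refine ⟨_, hrep, ?_⟩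
  have hsum := (partnerPerm hM).sum_cycleType
  rw [hrep, Multiset.sum_replicate, smul_eq_mul] at hsum
  have hfix : (partnerPerm hM).supportᶜ.card = (outerIsolated G L).card := by
    refine Finset.card_bij (fun x _ => x.1) (fun x hx => ?_) (fun x _ y _ h => Subtype.ext h)
      fun x hx => ?_
    · rw [Finset.mem_compl, Equiv.Perm.notMem_support] at hx
      exact (partner_eq_self_iff hM x).mp hx
    · have hxL : x ∉ L := (Finset.mem_filter.mp hx).2.1
      refine ⟨⟨x, hxL⟩, ?_, rfl⟩
      rw [Finset.mem_compl, Equiv.Perm.notMem_support]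
      exact (partner_eq_self_iff hM ⟨x, hxL⟩).mpr hx
  have hcompl := Finset.card_add_card_compl (partnerPerm hM).support
  rw [Fintype.card_subtype_compl, Fintype.card_fin, Fintype.card_coe] at hcompl
  have hL := L.card_le_univ
  rw [Fintype.card_fin] at hL
  rw [mul_comm]
  omega

theorem cycleType_permCongr {α β : Type*} [Fintype α] [DecidableEq α] [Fintype β] [DecidableEq β]
    (e : α ≃ β) (σ : Equiv.Perm α) : (e.permCongr σ).cycleType = σ.cycleType := by
  have huniv : ∀ x : β, True := fun _ => trivial
  rw [← Equiv.Perm.cycleType_extendDomain (e.trans (Equiv.subtypeUnivEquiv huniv).symm)]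
  congr 1

theorem IsJoinMatching.nonempty_iso {n : ℕ} {G H : SimpleGraph (Fin n)} {L K : Finset (Fin n)}
    (hG : IsJoinMatching G L) (hH : IsJoinMatching H K) (hcard : L.card = K.card) :
    Nonempty (G ≃g H) := by
  have e₁ : {x // x ∈ L} ≃ {x // x ∈ K} := Fintype.equivOfCardEq (by simpa using hcard)
  have e₂ : {x // ¬ x ∈ L} ≃ {x // ¬ x ∈ K} := Fintype.equivOfCardEq (by
    rw [Fintype.card_subtype_compl, Fintype.card_subtype_compl]
    simp [hcard])
  obtain ⟨k, hk, hkn⟩ := cycleType_partnerPerm hG.matching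
  obtain ⟨l, hl, hln⟩ := cycleType_partnerPerm hH.matching
  have hkl : k = l := by
    have h1 := hG.isolated
    have h2 := hH.isolated
    omega
  have hconj : IsConj (e₂.permCongr (partnerPerm hG.matching)) (partnerPerm hH.matching) := by
    rw [Equiv.Perm.isConj_iff_cycleType_eq, cycleType_permCongr, hl, ← hkl, ← hk]
  obtain ⟨c, hc⟩ := isConj_iff.mp hconj
  have hcomm : ∀ x, c (e₂ (partner G L x)) = partner H K (c (e₂ x)) := by
    intro x
    have := congrArg (fun σ => σ (c (e₂ x))) hc
    simpa [partnerPerm] using this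
  set e₃ := e₂.trans c with he₃
  have hcomm₃ : ∀ x, e₃ (partner G L x) = partner H K (e₃ x) := hcomm
  refine ⟨Equiv.subtypeCongr e₁ e₃, ?_⟩
  intro a b
  have hin : ∀ x (hx : x ∈ L), Equiv.subtypeCongr e₁ e₃ x = e₁ ⟨x, hx⟩ := by
    intro x hx
    simp [Equiv.subtypeCongr, hx]
  have hout : ∀ x (hx : ¬ x ∈ L), Equiv.subtypeCongr e₁ e₃ x = e₃ ⟨x, hx⟩ := by
    intro x hx
    simp [Equiv.subtypeCongr, hx]
  rcases eq_or_ne a b with rfl | hab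
  · simp
  have hab' := (Equiv.subtypeCongr e₁ e₃).injective.ne hab
  by_cases ha : a ∈ L
  · refine iff_of_true (hH.joined _ ?_ _ hab'.symm) (hG.joined a ha b hab.symm)
    rw [hin a ha]
    exact (e₁ _).2
  by_cases hb : b ∈ L
  · refine iff_of_true (hH.joined _ ?_ _ hab').symm (hG.joined b hb a hab).symm
    rw [hin b hb]
    exact (e₁ _).2
  rw [hout a ha, hout b hb]
  change H.Adj _ _ ↔ G.Adj (⟨a, ha⟩ : {x // ¬ x ∈ L}) (⟨b, hb⟩ : {x // ¬ x ∈ L})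
  rw [adj_iff_partner hH.matching, adj_iff_partner hG.matching, ← hcomm₃]
  simp

theorem IsJoinMatching.map {n : ℕ} {G H : SimpleGraph (Fin n)} {L : Finset (Fin n)}
    (hG : IsJoinMatching G L) (e : G ≃g H) :
    IsJoinMatching H (L.map e.toEquiv.toEmbedding) := by
  have hmem : ∀ x, x ∈ L.map e.toEquiv.toEmbedding ↔ e.symm x ∈ L := by
    intro x
    rw [Finset.mem_map_equiv]
    rfl
  have hadj : ∀ x y, H.Adj x y ↔ G.Adj (e.symm x) (e.symm y) :=
    fun x y => (e.symm.map_adj_iff).symm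
  refine ⟨fun i hi j hij => ?_, fun i j k hi hj hk hij hik => ?_, ?_⟩
  · rw [hadj]
    exact hG.joined _ ((hmem i).mp hi) _ (e.symm.injective.ne hij)
  · rw [hmem] at hi hj hk
    rw [hadj] at hij hik
    exact e.symm.injective (hG.matching _ _ _ hi hj hk hij hik)
  · refine le_trans (Finset.card_le_card_of_injOn e.symm (fun x hx => ?_)
      e.symm.injective.injOn) hG.isolated
    have hx' := Finset.mem_filter.mp hx
    refine Finset.mem_filter.mpr ⟨Finset.mem_univ _, fun h => hx'.2.1 ((hmem x).mpr h),
      fun j hj hxj => hx'.2.2 (e j) (fun h => hj ?_) ?_⟩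
    · simpa using (hmem _).mp h
    · rw [hadj]
      simpa using hxj

theorem isJoinMatching_Fnp {n p : ℕ} (hpn : p ≤ n) :
    ∃ L : Finset (Fin n), L.card = p ∧ IsJoinMatching (Fnp n p) L := by
  refine ⟨Finset.univ.filter fun i => i.val < p, ?_, ?_, ?_, ?_⟩
  · rw [Fin.card_filter_val_lt]
    omega
  · intro i hi j hij
    have hi' : i.val < p := (Finset.mem_filter.mp hi).2
    exact (SimpleGraph.fromRel_adj _ _ _).mpr ⟨hij.symm, Or.inl (Or.inl hi')⟩
  · intro i j k hi hj hk hij hik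
    simp only [Finset.mem_filter, Finset.mem_univ, true_and, not_lt] at hi hj hk
    simp only [Fnp, SimpleGraph.fromRel_adj, ne_eq, Fin.ext_iff] at hij hik
    ext
    omega
  · rw [Finset.card_le_one]
    have hlast : ∀ i ∈ outerIsolated (Fnp n p) (Finset.univ.filter fun i => i.val < p),
        p + 2 * ((n - p) / 2) ≤ i.val := by
      intro i hi
      obtain ⟨-, hiL, hi⟩ := Finset.mem_filter.mp hi
      simp only [Finset.mem_filter, Finset.mem_univ, true_and, not_lt] at hiL hi
      by_contra hlt
      have hj : p + 2 * ((i.val - p) / 2) + (1 - (i.val - p) % 2) < n := by omega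
      refine hi ⟨_, hj⟩ (by simp only; omega) ?_
      simp only [Fnp, SimpleGraph.fromRel_adj, ne_eq, Fin.ext_iff]
      omega
    intro a ha b hb
    have h1 := hlast a ha
    have h2 := hlast b hb
    ext
    omega

/-- The weight `1` on `L`, `z` on `U` and `y` elsewhere. -/
noncomputable def joinVec {n : ℕ} (L U : Finset (Fin n)) (y z : ℝ) (i : Fin n) : ℝ :=
  if i ∈ L then 1 else if i ∈ U then z else y

theorem joinVec_pos {n : ℕ} (L U : Finset (Fin n)) {y z : ℝ} (hy : 0 < y) (hz : 0 < z)
    (i : Fin n) : 0 < joinVec L U y z i := by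
  unfold joinVec
  split_ifs <;> linarith

theorem sum_joinVec {n : ℕ} {L U : Finset (Fin n)} (hUL : Disjoint L U) (y z : ℝ) :
    ∑ i, joinVec L U y z i = L.card + U.card * z + (n - L.card - U.card) * y := by
  have hterm : ∀ i, joinVec L U y z i =
      y + (if i ∈ L then 1 - y else 0) + (if i ∈ U then z - y else 0) := by
    intro i
    unfold joinVec
    by_cases hL : i ∈ L
    · simp [hL, Finset.disjoint_left.mp hUL hL]
    · by_cases hU : i ∈ U <;> simp [hL, hU]
  rw [Finset.sum_congr rfl fun i _ => hterm i, Finset.sum_add_distrib, Finset.sum_add_distrib,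
    Finset.sum_ite_mem, Finset.sum_ite_mem, Finset.univ_inter, Finset.univ_inter]
  simp only [Finset.sum_const, Finset.card_univ, Fintype.card_fin, nsmul_eq_mul]
  ring

/-- A vertex where `G` has all the edges of a join of `L` with a matching missing `U`. -/
def Saturated {n : ℕ} (G : SimpleGraph (Fin n)) (L U : Finset (Fin n)) (i : Fin n) : Prop :=
  (∀ j ∈ L, j ≠ i → G.Adj i j) ∧ (i ∈ L → ∀ j, j ≠ i → G.Adj i j) ∧
    (i ∉ L → i ∉ U → ∃ j, j ∉ L ∧ G.Adj i j)

/-- For a vector equal to `1` at `i`, the action at `i` is largest when `i` is joined to all. -/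
theorem qAct_le_of_eq_one {n : ℕ} (G : SimpleGraph (Fin n)) {v : Fin n → ℝ}
    (hv : ∀ i, 0 < v i) {i : Fin n} (hi : v i = 1) :
    qAct G v i ≤ n - 2 + ∑ j, v j ∧
      (qAct G v i = n - 2 + ∑ j, v j ↔ ∀ j, j ≠ i → G.Adj i j) := by
  have hsum : (n : ℝ) - 2 + ∑ j, v j = ∑ j, if j = i then 0 else v i + v j := by
    have : ∀ j, (if j = i then 0 else v i + v j) = (1 + v j) - if j = i then 2 else 0 := by
      intro j
      split_ifs with h
      · rw [h, hi]; norm_num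
      · rw [hi]; ring
    rw [Finset.sum_congr rfl fun j _ => this j, Finset.sum_sub_distrib, Finset.sum_add_distrib]
    simp
    ring
  have hterm : ∀ j ∈ Finset.univ, (if G.Adj i j then v i + v j else 0) ≤
      if j = i then 0 else v i + v j := by
    intro j _
    by_cases hj : j = i
    · simp [hj]
    · by_cases hadj : G.Adj i j <;> simp [hj, hadj, (add_pos (hv i) (hv j)).le]
  rw [hsum]
  refine ⟨Finset.sum_le_sum hterm, ?_⟩
  rw [qAct, Finset.sum_eq_sum_iff_of_le hterm]
  refine forall_congr' fun j => ?_
  by_cases hj : j = i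
  · simp [hj]
  · by_cases hadj : G.Adj i j <;> simp [hj, hadj, (add_pos (hv i) (hv j)).ne]

theorem qAct_joinVec {n : ℕ} {G : SimpleGraph (Fin n)} {L U : Finset (Fin n)}
    (hM : OuterMatching G L) (hU : U ⊆ outerIsolated G L) {s y z : ℝ} (hy : 0 < y) (hz : 0 < z)
    (hsy : L.card * (y + 1) + 2 * y = s * y) (hsz : L.card * (z + 1) = s * z)
    (hs : n - 2 + (L.card + U.card * z + (n - L.card - U.card) * y) = s) (i : Fin n) :
    qAct G (joinVec L U y z) i ≤ s * joinVec L U y z i ∧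
      (qAct G (joinVec L U y z) i = s * joinVec L U y z i ↔ Saturated G L U i) := by
  have hUL : Disjoint L U := Finset.disjoint_left.mpr fun x hx hxU =>
    (Finset.mem_filter.mp (hU hxU)).2.1 hx
  have hv := joinVec_pos L U hy hz
  by_cases hiL : i ∈ L
  · have hi : joinVec L U y z i = 1 := by simp [joinVec, hiL]
    have h := qAct_le_of_eq_one G hv hi
    rw [sum_joinVec hUL, hs] at h
    rw [hi, mul_one]
    refine ⟨h.1, h.2.trans ⟨fun h' => ⟨fun j _ => h' j, fun _ => h', absurd hiL⟩,
      fun h' => h'.2.1 hiL⟩⟩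
  set a := joinVec L U y z i with ha
  have hinner : ∀ j ∈ L, (if G.Adj i j then a + joinVec L U y z j else 0) ≤ a + 1 := by
    intro j hj
    have hj1 : joinVec L U y z j = 1 := by simp [joinVec, hj]
    rw [hj1]
    split_ifs
    · exact le_rfl
    · linarith [hv i]
  have hinner_le : ∑ j ∈ L, (if G.Adj i j then a + joinVec L U y z j else 0) ≤
      L.card * (a + 1) := by
    refine (Finset.sum_le_sum hinner).trans ?_
    simp [mul_add]
  have hinner_eq : ∑ j ∈ L, (if G.Adj i j then a + joinVec L U y z j else 0) =
      L.card * (a + 1) ↔ ∀ j ∈ L, j ≠ i → G.Adj i j := by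
    have hconst : (L.card : ℝ) * (a + 1) = ∑ j ∈ L, (a + 1) := by simp [mul_add]
    rw [hconst, Finset.sum_eq_sum_iff_of_le hinner]
    refine forall₂_congr fun j hj => ?_
    have hj1 : joinVec L U y z j = 1 := by simp [joinVec, hj]
    have hji : j ≠ i := fun h => hiL (h ▸ hj)
    have : (0 : ℝ) ≠ a + 1 := by linarith [hv i]
    by_cases hadj : G.Adj i j <;> simp [hj1, hji, hadj, this]
  have hsplit : qAct G (joinVec L U y z) i =
      ∑ j ∈ L, (if G.Adj i j then a + joinVec L U y z j else 0) +
      ∑ j ∈ Lᶜ, (if G.Adj i j then a + joinVec L U y z j else 0) :=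
    (Finset.sum_add_sum_compl L _).symm
  by_cases hex : ∃ j, j ∉ L ∧ G.Adj i j
  · obtain ⟨j, hjL, hij⟩ := hex
    have hiU : i ∉ U := fun h => (Finset.mem_filter.mp (hU h)).2.2 j hjL hij
    have hjU : j ∉ U := fun h => (Finset.mem_filter.mp (hU h)).2.2 i hiL hij.symm
    have hay : a = y := by simp [ha, joinVec, hiL, hiU]
    have houter : ∑ j ∈ Lᶜ, (if G.Adj i j then a + joinVec L U y z j else 0) = 2 * y := by
      rw [Finset.sum_eq_single j]
      · simp [hij, hay, joinVec, hjL, hjU]; ring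
      · intro k hk hkj
        rw [if_neg fun hik => hkj (hM i k j hiL (Finset.mem_compl.mp hk) hjL hik hij)]
      · exact fun h => absurd (Finset.mem_compl.mpr hjL) h
    rw [houter] at hsplit
    rw [hay] at hsplit hinner_le hinner_eq ⊢
    refine ⟨by linarith, ⟨fun h => ⟨hinner_eq.mp (by linarith), fun h' => absurd h' hiL,
      fun _ _ => ⟨j, hjL, hij⟩⟩, fun h => ?_⟩⟩
    have := hinner_eq.mpr h.1
    linarith
  · have houter : ∑ j ∈ Lᶜ, (if G.Adj i j then a + joinVec L U y z j else 0) = 0 :=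
      Finset.sum_eq_zero fun j hj =>
        if_neg fun hij => hex ⟨j, Finset.mem_compl.mp hj, hij⟩
    rw [houter] at hsplit
    by_cases hiU : i ∈ U
    · have haz : a = z := by simp [ha, joinVec, hiL, hiU]
      rw [haz] at hsplit hinner_le hinner_eq ⊢
      refine ⟨by linarith, ⟨fun h => ⟨hinner_eq.mp (by linarith), fun h' => absurd h' hiL,
        fun _ h' => absurd hiU h'⟩, fun h => ?_⟩⟩
      have := hinner_eq.mpr h.1
      linarith
    · have hay : a = y := by simp [ha, joinVec, hiL, hiU]
      rw [hay] at hsplit hinner_le hinner_eq ⊢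
      exact ⟨by linarith, ⟨fun h => absurd h (by linarith), fun h => absurd (h.2.2 hiL hiU) hex⟩⟩

/-- If few vertices have large degree, the signless Laplacian spectral radius is small. -/
theorem qRad_le_of_few_large_degrees {n p C : ℕ} (hp : 1 ≤ p) (G : SimpleGraph (Fin n))
    {L : Finset (Fin n)} (hL : L.card + 1 ≤ p)
    (hdeg : ∀ i, i ∉ L → G.degree i ≤ C) (hn : p * (2 * C + 3) ≤ n) :
    qRad G ≤ n + 2 * p - 3 := by
  have hp' : (1 : ℝ) ≤ p := by exact_mod_cast hp
  have hL' : (L.card : ℝ) + 1 ≤ p := by exact_mod_cast hL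
  have hn' : (p : ℝ) * (2 * C + 3) ≤ n := by exact_mod_cast hn
  have hC : (0 : ℝ) ≤ C := C.cast_nonneg
  have hn3 : (3 : ℝ) ≤ n := by nlinarith
  have hnpos : (0 : ℝ) < n := by linarith
  set y : ℝ := p / n with hy
  have hny : (n : ℝ) * y = p := by rw [hy]; field_simp
  have hypos : 0 < y := by positivity
  have hv := joinVec_pos L ∅ hypos hypos
  refine qRad_le_of_qAct_le G hv (by linarith) fun i => ?_
  by_cases hiL : i ∈ L
  · have hi : joinVec L ∅ y y i = 1 := by simp [joinVec, hiL]
    have h := (qAct_le_of_eq_one G hv hi).1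
    rw [sum_joinVec (Finset.disjoint_empty_right L)] at h
    simp only [Finset.card_empty, Nat.cast_zero, zero_mul] at h
    rw [hi]
    have : 0 ≤ (L.card : ℝ) * y := by positivity
    nlinarith
  · have hi : joinVec L ∅ y y i = y := by simp [joinVec, hiL]
    have hbound : qAct G (joinVec L ∅ y y) i ≤
        ∑ j, ((if G.Adj i j then 2 * y else 0) + if j ∈ L then 1 else 0) := by
      refine Finset.sum_le_sum fun j _ => ?_
      rw [hi]
      by_cases hjL : j ∈ L <;> by_cases hadj : G.Adj i j <;>
        simp [joinVec, hjL, hadj] <;> linarith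
    have hcount : ∑ j, ((if G.Adj i j then 2 * y else 0) + if j ∈ L then (1 : ℝ) else 0) =
        G.degree i * (2 * y) + L.card := by
      rw [Finset.sum_add_distrib, ← Finset.sum_filter, Finset.sum_ite_mem, Finset.univ_inter,
        ← SimpleGraph.neighborFinset_eq_filter]
      simp
    rw [hcount] at hbound
    have hd : (G.degree i : ℝ) ≤ C := by exact_mod_cast hdeg i hiL
    have hd' := mul_le_mul_of_nonneg_right hd (by linarith : (0 : ℝ) ≤ 2 * y)
    have hsmall : (2 * C + 3) * y ≤ 1 := by
      rw [hy, mul_div_assoc', div_le_one hnpos]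
      linarith
    have : 0 ≤ (p : ℝ) * y := by positivity
    rw [hi]
    nlinarith

/-- `j` disjoint copies of `P₃` in `G` that avoid `X`. -/
def PathsAvoiding {V : Type*} (G : SimpleGraph V) (j : ℕ) (X : Finset V) : Prop :=
  ∃ f : Fin j → Fin 3 → V,
    (∀ i a i' a', f i a = f i' a' → i = i' ∧ a = a') ∧
    (∀ i, G.Adj (f i 0) (f i 1) ∧ G.Adj (f i 1) (f i 2)) ∧ ∀ i a, f i a ∉ X

theorem PathsAvoiding.containsLinearForest {V : Type*} {G : SimpleGraph V} {j : ℕ} {X : Finset V}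
    (h : PathsAvoiding G j X) : ContainsLinearForest G (fun _ : Fin j => 3) := by
  obtain ⟨f, hinj, hadj, -⟩ := h
  refine ⟨f, ?_, fun i a b hab => ?_⟩
  · rintro ⟨i, a⟩ ⟨i', a'⟩ h
    obtain ⟨rfl, rfl⟩ := hinj i a i' a' h
    rfl
  · have h01 := (hadj i).1
    have h12 := (hadj i).2
    rw [SimpleGraph.pathGraph_adj] at hab
    fin_cases a <;> fin_cases b <;> first | exact h01 | exact h12 | exact h01.symm | exact h12.symm | simp at hab

theorem PathsAvoiding.cons {V : Type*} [DecidableEq V] {G : SimpleGraph V} {j : ℕ} {X : Finset V} {a b c : V}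
    (h : PathsAvoiding G j (X ∪ {a, b, c})) (hab : G.Adj a b) (hbc : G.Adj b c) (hac : a ≠ c)
    (ha : a ∉ X) (hb : b ∉ X) (hc : c ∉ X) : PathsAvoiding G (j + 1) X := by
  obtain ⟨f, hinj, hadj, havoid⟩ := h
  have hnew : ∀ k, (![a, b, c] : Fin 3 → V) k ∈ X ∪ {a, b, c} := by
    intro k
    fin_cases k <;> simp
  have hself : ∀ k l, (![a, b, c] : Fin 3 → V) k = ![a, b, c] l → k = l := by
    intro k l
    have h1 := hab.ne
    have h2 := hbc.ne
    fin_cases k <;> fin_cases l <;> simp [h1, h2, hac, h1.symm, h2.symm, hac.symm]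
  refine ⟨Fin.cons ![a, b, c] f, ?_, ?_, ?_⟩
  · intro i k i' k'
    refine Fin.cases ?_ (fun i => ?_) i <;> refine Fin.cases ?_ (fun i' => ?_) i' <;>
      simp only [Fin.cons_zero, Fin.cons_succ]
    · exact fun h => ⟨trivial, hself k k' h⟩
    · exact fun h => absurd (h ▸ hnew k) (havoid i' k')
    · exact fun h => absurd (h ▸ hnew k') (havoid i k)
    · intro h
      obtain ⟨rfl, rfl⟩ := hinj _ _ _ _ h
      exact ⟨rfl, rfl⟩
  · intro i
    refine Fin.cases ?_ (fun i => ?_) i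
    · simpa using ⟨hab, hbc⟩
    · simpa using hadj i
  · intro i k
    refine Fin.cases ?_ (fun i => ?_) i
    · fin_cases k <;> simp [ha, hb, hc]
    · simpa using fun h => havoid i k (Finset.mem_union_left _ h)

/-- Vertices of large degree are the centres of disjoint copies of `P₃`. -/
theorem pathsAvoiding_of_degree {V : Type*} [Fintype V] [DecidableEq V] (G : SimpleGraph V) (C : ℕ)
    (B : Finset V) : ∀ X : Finset V, (∀ b ∈ B, C ≤ G.degree b) → Disjoint B X →
      X.card + 3 * B.card ≤ C → PathsAvoiding G B.card X := by
  induction B using Finset.induction_on with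
  | empty =>
    intro X _ _ _
    exact ⟨fun i => Fin.elim0 (by simpa using i), fun i => Fin.elim0 (by simpa using i),
      fun i => Fin.elim0 (by simpa using i), fun i => Fin.elim0 (by simpa using i)⟩
  | insert b B hb ih =>
    intro X hdeg hdisj hcard
    rw [Finset.card_insert_of_notMem hb] at hcard ⊢
    rw [Finset.disjoint_insert_left] at hdisj
    have hlarge : 1 < (G.neighborFinset b \ (X ∪ B)).card := by
      have h1 := Finset.le_card_sdiff (X ∪ B) (G.neighborFinset b)
      have h2 := Finset.card_union_le X B
      have h3 := hdeg b (Finset.mem_insert_self b B)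
      rw [G.card_neighborFinset_eq_degree] at h1
      omega
    obtain ⟨a, ha, c, hc, hac⟩ := Finset.one_lt_card.mp hlarge
    simp only [Finset.mem_sdiff, SimpleGraph.mem_neighborFinset, Finset.mem_union,
      not_or] at ha hc
    refine PathsAvoiding.cons (a := a) (b := b) (c := c) (ih _ ?_ ?_ ?_) ha.1.symm hc.1 hac
      ha.2.1 hdisj.1 hc.2.1
    · exact fun x hx => hdeg x (Finset.mem_insert_of_mem hx)
    · rw [Finset.disjoint_union_right]
      refine ⟨hdisj.2, ?_⟩
      simp [ha.2.2, hb, hc.2.2]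
    · have h1 := Finset.card_union_le X {a, b, c}
      have h2 : ({a, b, c} : Finset V).card ≤ 3 := Finset.card_le_three
      omega

theorem forest_free_dichotomy {n p : ℕ} (G : SimpleGraph (Fin n))
    (hG : ¬ ContainsLinearForest G (fun _ : Fin (p + 1) => 3)) :
    ∃ L : Finset (Fin n), (L.card = p ∧ OuterMatching G L) ∨
      (L.card + 1 ≤ p ∧ ∀ i, i ∉ L → G.degree i ≤ 3 * (p + 1)) := by
  set L : Finset (Fin n) := Finset.univ.filter fun i => 3 * (p + 1) ≤ G.degree i with hL
  have hmem : ∀ i, i ∈ L ↔ 3 * (p + 1) ≤ G.degree i := by simp [hL]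
  refine ⟨L, ?_⟩
  have hle : L.card ≤ p := by
    by_contra hlt
    obtain ⟨B, hBL, hB⟩ := Finset.exists_subset_card_eq (show p + 1 ≤ L.card by omega)
    have := pathsAvoiding_of_degree G (3 * (p + 1)) B ∅ (fun b hb => (hmem b).mp (hBL hb))
      (Finset.disjoint_empty_right B) (by simp [hB])
    rw [hB] at this
    exact hG this.containsLinearForest
  rcases hle.eq_or_lt with hp | hp
  · refine Or.inl ⟨hp, fun i j k hi hj hk hij hik => ?_⟩
    by_contra hjk
    have h3 : ({j, i, k} : Finset (Fin n)).card ≤ 3 := Finset.card_le_three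
    have := pathsAvoiding_of_degree G (3 * (p + 1)) L (∅ ∪ {j, i, k})
      (fun b hb => (hmem b).mp hb) (by simp [hi, hj, hk]) (by rw [Finset.empty_union]; omega)
    rw [hp] at this
    exact hG (this.cons (X := ∅) hij.symm hik hjk (by simp) (by simp) (by simp)).containsLinearForest
  · refine Or.inr ⟨hp, fun i hi => ?_⟩
    rw [hmem] at hi
    omega

theorem exists_subset_outerIsolated {n : ℕ} {G : SimpleGraph (Fin n)} {L : Finset (Fin n)}
    (hM : OuterMatching G L) :
    ∃ U ⊆ outerIsolated G L, U.card = (n - L.card) % 2 ∧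
      ((outerIsolated G L).card ≤ 1 → U = outerIsolated G L) := by
  obtain ⟨k, -, hk⟩ := cycleType_partnerPerm hM
  obtain ⟨U, hU, hcard⟩ := Finset.exists_subset_card_eq
    (show (n - L.card) % 2 ≤ (outerIsolated G L).card by omega)
  exact ⟨U, hU, hcard, fun h => Finset.eq_of_subset_of_card_le hU (by omega)⟩

/-- The extremal statement, with `s` described by the eigenvalue equations of `Fnp n p`. -/
theorem qRad_le_and_eq_iff {n p : ℕ} (hp : 1 ≤ p) (hn : p * (2 * (3 * (p + 1)) + 3) ≤ n)
    {s y z : ℝ} (hs_large : (n : ℝ) + 2 * p - 3 < s) (hy : 0 < y) (hz : 0 < z)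
    (hsy : p * (y + 1) + 2 * y = s * y) (hsz : p * (z + 1) = s * z)
    (hs : n - 2 + (p + ((n - p) % 2 : ℕ) * z + (n - p - ((n - p) % 2 : ℕ)) * y) = s)
    (G : SimpleGraph (Fin n)) (hG : ¬ ContainsLinearForest G (fun _ : Fin (p + 1) => 3)) :
    qRad G ≤ s ∧ (qRad G = s ↔ Nonempty (G ≃g Fnp n p)) := by
  have hpn : p ≤ n := by nlinarith
  have hn3 : (3 : ℝ) ≤ n := by
    have : 3 ≤ n := by nlinarith
    exact_mod_cast this
  have hspos : 0 < s := by
    have : (0 : ℝ) ≤ p := p.cast_nonneg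
    linarith
  obtain ⟨K, hK, hFK⟩ := isJoinMatching_Fnp hpn
  have hback : Nonempty (G ≃g Fnp n p) → qRad G = s := by
    rintro ⟨e⟩
    have hGK := hFK.map e.symm
    set L := K.map e.symm.toEquiv.toEmbedding with hL
    have hLp : L.card = p := by rw [hL, Finset.card_map, hK]
    obtain ⟨U, hU, hUcard, hUeq⟩ := exists_subset_outerIsolated hGK.matching
    rw [hLp] at hUcard
    rw [← hLp] at hsy hsz
    rw [← hUcard, ← hLp] at hs
    refine qRad_eq_of_qAct_eq G (by omega) (joinVec_pos L U hy hz) hspos.le fun i => ?_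
    refine (qAct_joinVec hGK.matching hU hy hz hsy hsz hs i).2.mpr
      ⟨fun j hj hji => (hGK.joined j hj i hji.symm).symm, hGK.joined i, fun hiL hiU => ?_⟩
    rw [hUeq hGK.isolated] at hiU
    by_contra hex
    exact hiU (Finset.mem_filter.mpr ⟨Finset.mem_univ _, hiL, fun j hj hij => hex ⟨j, hj, hij⟩⟩)
  obtain ⟨L, ⟨hLp, hM⟩ | ⟨hLp, hdeg⟩⟩ := forest_free_dichotomy G hG
  · obtain ⟨U, hU, hUcard, -⟩ := exists_subset_outerIsolated hM
    rw [hLp] at hUcard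
    rw [← hLp] at hsy hsz
    rw [← hUcard, ← hLp] at hs
    have hact := qAct_joinVec hM hU hy hz hsy hsz hs
    refine ⟨qRad_le_of_qAct_le G (joinVec_pos L U hy hz) hspos.le fun i => (hact i).1,
      fun hq => ?_, hback⟩
    obtain ⟨S, ⟨i, hi⟩, hS⟩ := exists_tight_of_qRad_eq G (joinVec_pos L U hy hz) hspos
      (fun i => (hact i).1) hq
    have hsat : ∀ i ∈ S, Saturated G L U i := fun i hi => (hact i).2.mp (hS i hi).1
    obtain ⟨u, hu⟩ : L.Nonempty := Finset.card_pos.mp (by omega)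
    have huS : u ∈ S := by
      rcases eq_or_ne u i with rfl | hui
      · exact hi
      · exact (hS i hi).2 u ((hsat i hi).1 u hu hui)
    have hall : ∀ j, Saturated G L U j := by
      intro j
      rcases eq_or_ne j u with rfl | hju
      · exact hsat j huS
      · exact hsat j ((hS u huS).2 j ((hsat u huS).2.1 hu j hju))
    have hGL : IsJoinMatching G L := by
      refine ⟨fun i hi => (hall i).2.1 hi, hM, ?_⟩
      have hsub : outerIsolated G L ⊆ U := by
        intro x hx
        obtain ⟨-, hxL, hx⟩ := Finset.mem_filter.mp hx
        by_contra hxU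
        obtain ⟨j, hj, hxj⟩ := (hall x).2.2 hxL hxU
        exact hx j hj hxj
      have := Finset.card_le_card hsub
      omega
    exact hGL.nonempty_iso hFK (by rw [hLp, hK])
  · have hlt := (qRad_le_of_few_large_degrees hp G hLp hdeg hn).trans_lt hs_large
    exact ⟨hlt.le, fun h => absurd h hlt.ne, hback⟩

theorem q_le_of_P3_forest_free (ℓ : ℕ) (hℓ : 1 ≤ ℓ)
    (p : ℕ) (hp : p + 1 = ℓ) (hp1 : 1 ≤ p) :
    ∃ N : ℕ, ∀ n : ℕ, N ≤ n → ∀ G : SimpleGraph (Fin n),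
      ¬ ContainsLinearForest G (fun _ : Fin ℓ => 3) →
      (Even (n - p) →
        qRad G ≤ ((n : ℝ) + 2 * (p : ℝ) +
          Real.sqrt (((n : ℝ) + 2 * (p : ℝ) - 4) ^ 2 - 8 * (p : ℝ) * ((p : ℝ) - 2))) / 2 ∧
        (qRad G = ((n : ℝ) + 2 * (p : ℝ) +
          Real.sqrt (((n : ℝ) + 2 * (p : ℝ) - 4) ^ 2 - 8 * (p : ℝ) * ((p : ℝ) - 2))) / 2 ↔ Nonempty (G ≃g Fnp n p))) ∧
      (¬ Even (n - p) →
        ∀ t : ℝ, IsGreatest {x : ℝ | gpoly n p x - 2 * (p : ℝ) * ((n : ℝ) - (p : ℝ) - 3) = 0} t →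
          qRad G ≤ t ∧ (qRad G = t ↔ Nonempty (G ≃g Fnp n p))) := by
  subst hp
  refine ⟨p * (2 * (3 * (p + 1)) + 3), fun n hn G hG => ?_⟩
  have hp' : (1 : ℝ) ≤ p := by exact_mod_cast hp1
  have hn' : (p : ℝ) * (6 * p + 9) ≤ n := by
    have : p * (6 * p + 9) ≤ n := by linarith
    exact_mod_cast this
  constructor
  · intro heven
    set d : ℝ := ((n : ℝ) + 2 * p - 4) ^ 2 - 8 * p * (p - 2) with hd
    set s : ℝ := ((n : ℝ) + 2 * p + √d) / 2 with hs
    have hlow : (n + 2 * p - 6 : ℝ) < √d := by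
      refine Real.lt_sqrt_of_sq_lt ?_
      rw [hd]
      nlinarith
    have hd0 : 0 ≤ d := by
      rw [hd]
      nlinarith
    have hroot : s ^ 2 - (n + 2 * p) * s + (2 * n + 2 * p ^ 2 - 4) = 0 := by
      have hsq := Real.sq_sqrt hd0
      rw [hs]
      nlinarith
    have hlarge : (n : ℝ) + 2 * p - 3 < s := by
      rw [hs]
      linarith
    have h2 : 0 < s - p - 2 := by nlinarith
    have h0 : 0 < s - p := by linarith
    refine qRad_le_and_eq_iff (y := p / (s - p - 2)) (z := p / (s - p)) hp1 hn hlarge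
      (by positivity) (by positivity) (by field_simp; ring) (by field_simp; ring) ?_ G hG
    rw [Nat.even_iff.mp heven]
    field_simp
    push_cast
    linear_combination (-(s - p)) * hroot
  · intro hodd t ht
    have hroot : (t - p) * (t ^ 2 - (n + 2 * p) * t + (2 * n + 2 * p ^ 2 - 4)) + 2 * p = 0 := by
      have h := ht.1
      simp only [Set.mem_ofPred_eq, gpoly] at h
      linear_combination h
    have hlarge : (n : ℝ) + 2 * p - 3 < t := by
      set g : ℝ → ℝ := fun x => gpoly n p x - 2 * (p : ℝ) * ((n : ℝ) - (p : ℝ) - 3) with hg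
      have hgx : ∀ x, g x =
          (x - p) * (x ^ 2 - (n + 2 * p) * x + (2 * n + 2 * p ^ 2 - 4)) + 2 * p := by
        intro x
        simp only [hg, gpoly]
        ring
      have hcont : Continuous g := by
        simp only [hg, gpoly]
        fun_prop
      have hneg : g (n + 2 * p - 3) < 0 := by
        rw [hgx]
        have h1 : (0 : ℝ) < n + p - 3 := by nlinarith
        have h2 : (2 * p : ℝ) < n - 2 * p ^ 2 + 6 * p - 5 := by nlinarith
        have h3 : (1 : ℝ) ≤ n + p - 3 := by nlinarith
        nlinarith
      have hpos : 0 < g (n + 2 * p) := by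
        rw [hgx]
        have h1 : (0 : ℝ) < n + 2 * p - p := by nlinarith
        have h2 : (0 : ℝ) < 2 * n + 2 * p ^ 2 - 4 := by nlinarith
        nlinarith [mul_pos h1 h2]
      obtain ⟨x, hx, hx0⟩ := intermediate_value_Ioo
        (show (n + 2 * p - 3 : ℝ) ≤ n + 2 * p by linarith) hcont.continuousOn ⟨hneg, hpos⟩
      exact hx.1.trans_le (ht.2 hx0)
    have h2 : 0 < t - p - 2 := by nlinarith
    have h0 : 0 < t - p := by linarith
    refine qRad_le_and_eq_iff (y := p / (t - p - 2)) (z := p / (t - p)) hp1 hn hlarge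
      (by positivity) (by positivity) (by field_simp; ring) (by field_simp; ring) ?_ G hG
    rw [Nat.not_even_iff.mp hodd]
    field_simp
    push_cast
    linear_combination (-1) * hroot
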